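/- arXiv:1309.1294 — 3 statements merged into one kernel-verified Lean document; each statement's English description precedes it below -/
import Mathlib

section
/- Let Q be a unital C*-algebra, N ≥ 1 an integer, and U ⊆ ℝ^N a nonempty open connected set. For k = 1,…,N let Φ_k : U → Q be infinitely differentiable (C^∞) maps, and write D^k_i(y) = ∂Φ_k/∂y_i(y) and D^k_{ij}(y) = ∂²Φ_k/∂y_i∂y_j(y) for the first and second partial derivatives. Assume that for every y ∈ U: (a) each D^k_i(y) is self-adjoint, i.e. (D^k_i(y))* = D^k_i(y); (b) the N×N matrix B(y) with entries B(y)_{ik} = D^k_i(y) is a unitary element of the matrix algebra M_N(Q); and (c) every second-order partial derivative commutes with every first-order one, i.e. D^k_{ij}(y)·D^l_m(y) = D^l_m(y)·D^k_{ij}(y) for all indices i,j,k,l,m. Then each Φ_k is affine: there exist elements q_k and q_{kj} of Q (k,j = 1,…,N) such that Φ_k(y) = q_k + Σ_{j=1}^N y_j • q_{kj} for all y ∈ U. -/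
open Matrix

/-- A three-index array that is symmetric in its first two indices and antisymmetric under
exchanging the first and the third vanishes in a real vector space. -/
theorem eq_zero_of_symm_of_antisymm {ι M : Type*} [AddCommGroup M] [Module ℝ M]
    (T : ι → ι → ι → M) (hs : ∀ i j m, T i j m = T j i m)
    (ha : ∀ i j m, T i j m + T m j i = 0) (i j m : ι) : T i j m = 0 := by
  have ha' : ∀ i j m, T i j m = -T m j i := fun i j m => eq_neg_of_add_eq_zero_left (ha i j m)
  have h : T i j m = -T i j m := by
    calc T i j m = -T m j i := ha' i j m
      _ = -T j m i := by rw [hs]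
      _ = T i m j := by rw [ha' j m i, neg_neg]
      _ = T m i j := hs _ _ _
      _ = -T j i m := ha' _ _ _
      _ = -T i j m := by rw [hs]
  have h2 : (2 : ℝ) • T i j m = 0 := by rw [two_smul, ← eq_neg_iff_add_eq_zero]; exact h
  exact (smul_eq_zero.mp h2).resolve_left two_ne_zero

/-- On an open preconnected set, a differentiable map all of whose partial derivatives are
constant is affine. -/
theorem exists_affine_of_partial_const {E : Type*} [NormedAddCommGroup E] [NormedSpace ℝ E]
    {N : ℕ} {U : Set (Fin N → ℝ)} (hU : IsOpen U) (hc : IsPreconnected U)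
    {f : (Fin N → ℝ) → E} (hf : DifferentiableOn ℝ f U) (a : Fin N → E)
    (ha : ∀ y ∈ U, ∀ i, fderiv ℝ f y (Pi.single i 1) = a i) :
    ∃ q : E, ∀ y ∈ U, f y = q + ∑ j, y j • a j := by
  let L : (Fin N → ℝ) →L[ℝ] E :=
    ∑ j, (ContinuousLinearMap.proj (R := ℝ) (φ := fun _ : Fin N => ℝ) j).smulRight (a j)
  have hL : ∀ y, L y = ∑ j, y j • a j := fun y => by
    simp [L]
  have hfL : ∀ y ∈ U, fderiv ℝ f y = L := fun y hy => by
    refine ContinuousLinearMap.coe_injective (LinearMap.pi_ext' fun i => LinearMap.ext_ring ?_)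
    simp [ha y hy, hL, Pi.single_apply, ite_smul]
  obtain ⟨q, hq⟩ := hU.exists_is_const_of_fderiv_eq_zero (𝕜 := ℝ) hc
    (f := fun y => f y - L y) (hf.sub L.differentiable.differentiableOn) (fun y hy => by
      rw [fderiv_fun_sub (hf.differentiableAt (hU.mem_nhds hy)) L.differentiableAt, L.fderiv,
        hfL y hy, sub_self]
      rfl)
  exact ⟨q, fun y hy => by rw [← hL, ← hq y hy, sub_add_cancel]⟩

/-- A smooth family of maps into a unital C*-algebra on a nonempty open
connected subset of ℝ^N whose first partial derivatives are self-adjoint and form a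
unitary matrix, and whose second partial derivatives commute with all first partial
derivatives, must be affine. -/
theorem stmt_0 {Q : Type*} [NormedRing Q] [StarRing Q] [CStarRing Q]
    [NormedAlgebra ℝ Q] [CompleteSpace Q]
    (N : ℕ) (hN : 1 ≤ N)
    (U : Set (Fin N → ℝ)) (hUopen : IsOpen U) (hUconn : IsConnected U)
    (Φ : Fin N → (Fin N → ℝ) → Q)
    (hΦ : ∀ k, ContDiffOn ℝ (⊤ : ℕ∞) (Φ k) U)
    (hsa : ∀ y ∈ U, ∀ k i : Fin N,
      star (fderiv ℝ (Φ k) y (Pi.single i 1)) = fderiv ℝ (Φ k) y (Pi.single i 1))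
    (hunitary : ∀ y ∈ U,
      (Matrix.of fun i k : Fin N => fderiv ℝ (Φ k) y (Pi.single i 1)) *
        (Matrix.of fun i k : Fin N => fderiv ℝ (Φ k) y (Pi.single i 1))ᴴ = 1 ∧
      (Matrix.of fun i k : Fin N => fderiv ℝ (Φ k) y (Pi.single i 1))ᴴ *
        (Matrix.of fun i k : Fin N => fderiv ℝ (Φ k) y (Pi.single i 1)) = 1)
    (hcomm : ∀ y ∈ U, ∀ i j k l m : Fin N,
      fderiv ℝ (fun z => fderiv ℝ (Φ k) z (Pi.single i 1)) y (Pi.single j 1) *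
        fderiv ℝ (Φ l) y (Pi.single m 1) =
      fderiv ℝ (Φ l) y (Pi.single m 1) *
        fderiv ℝ (fun z => fderiv ℝ (Φ k) z (Pi.single i 1)) y (Pi.single j 1)) :
    ∃ (q : Fin N → Q) (qm : Fin N → Fin N → Q),
      ∀ y ∈ U, ∀ k, Φ k y = q k + ∑ j, y j • qm k j := by
  have hat : ∀ k, ∀ y ∈ U, ContDiffAt ℝ 2 (Φ k) y := fun k y hy =>
    ((hΦ k).contDiffAt (hUopen.mem_nhds hy)).of_le (WithTop.coe_le_coe.mpr le_top)
  have hdd : ∀ k, ∀ y ∈ U, DifferentiableAt ℝ (fderiv ℝ (Φ k)) y := fun k y hy =>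
    ((hat k y hy).fderiv_right (m := 1) (by norm_num)).differentiableAt (by simp)
  have hpd : ∀ k i, ∀ y ∈ U,
      DifferentiableAt ℝ (fun z => fderiv ℝ (Φ k) z (Pi.single i 1)) y := fun k i y hy =>
    (hdd k y hy).clm_apply (differentiableAt_const _)
  have hsymm : ∀ k i j, ∀ y ∈ U,
      fderiv ℝ (fun z => fderiv ℝ (Φ k) z (Pi.single i 1)) y (Pi.single j 1) =
        fderiv ℝ (fun z => fderiv ℝ (Φ k) z (Pi.single j 1)) y (Pi.single i 1) := by
    intro k i j y hy
    have key := (hat k y hy).isSymmSndFDerivAt (by simp)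
    rw [fderiv_clm_apply (hdd k y hy) (differentiableAt_const _),
      fderiv_clm_apply (hdd k y hy) (differentiableAt_const _)]
    simpa using key (Pi.single j 1) (Pi.single i 1)
  have hrow : ∀ y ∈ U, ∀ i m : Fin N,
      ∑ k, fderiv ℝ (Φ k) y (Pi.single i 1) * fderiv ℝ (Φ k) y (Pi.single m 1) =
        (1 : Matrix (Fin N) (Fin N) Q) i m := by
    intro y hy i m
    rw [← (hunitary y hy).1]
    simp [Matrix.mul_apply, hsa y hy]
  have hcol : ∀ y ∈ U, ∀ k l : Fin N,
      ∑ m, fderiv ℝ (Φ k) y (Pi.single m 1) * fderiv ℝ (Φ l) y (Pi.single m 1) =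
        (1 : Matrix (Fin N) (Fin N) Q) k l := by
    intro y hy k l
    rw [← (hunitary y hy).2]
    simp [Matrix.mul_apply, hsa y hy]
  have hT : ∀ y ∈ U, ∀ i j m : Fin N,
      ∑ k, fderiv ℝ (fun z => fderiv ℝ (Φ k) z (Pi.single i 1)) y (Pi.single j 1) *
        fderiv ℝ (Φ k) y (Pi.single m 1) = 0 := by
    intro y hy
    refine eq_zero_of_symm_of_antisymm _ (fun i j m => ?_) (fun i j m => ?_)
    · exact Finset.sum_congr rfl fun k _ => by rw [hsymm k i j y hy]
    · have hd := HasFDerivAt.fun_sum (u := Finset.univ) fun k _ =>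
        (hpd k i y hy).hasFDerivAt.mul' (hpd k m y hy).hasFDerivAt
      have hz := (hd.congr_of_eventuallyEq (f₁ := fun _ => (1 : Matrix (Fin N) (Fin N) Q) i m) (by
        filter_upwards [hUopen.mem_nhds hy] with z hz
        exact (hrow z hz i m).symm)).unique (hasFDerivAt_const _ y)
      have hz' := congrArg (fun L => L (Pi.single j 1)) hz
      simp only [_root_.sum_apply, _root_.add_apply,
        _root_.smul_apply, _root_.zero_apply, smul_eq_mul,
        MulOpposite.smul_eq_mul_unop, MulOpposite.unop_op] at hz'
      rw [← Finset.sum_add_distrib, ← hz']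
      refine Finset.sum_congr rfl fun k _ => ?_
      rw [hcomm y hy m j k k i, add_comm]
  have hzero : ∀ y ∈ U, ∀ l i j : Fin N,
      fderiv ℝ (fun z => fderiv ℝ (Φ l) z (Pi.single i 1)) y (Pi.single j 1) = 0 := by
    intro y hy l i j
    set S : Fin N → Q := fun k =>
      fderiv ℝ (fun z => fderiv ℝ (Φ k) z (Pi.single i 1)) y (Pi.single j 1) with hS
    calc S l = ∑ k, S k * (1 : Matrix (Fin N) (Fin N) Q) k l := by
          simp [Matrix.one_apply]
      _ = ∑ m, (∑ k, S k * fderiv ℝ (Φ k) y (Pi.single m 1)) *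
            fderiv ℝ (Φ l) y (Pi.single m 1) := by
          simp_rw [← hcol y hy, Finset.mul_sum, Finset.sum_mul, mul_assoc]
          exact Finset.sum_comm
      _ = 0 := Finset.sum_eq_zero fun m _ => by rw [hT y hy i j m, zero_mul]
  have hconst : ∀ k i, ∃ a : Q, ∀ y ∈ U, fderiv ℝ (Φ k) y (Pi.single i 1) = a := fun k i => by
    obtain ⟨a, ha⟩ := exists_affine_of_partial_const hUopen hUconn.isPreconnected
      (fun y hy => (hpd k i y hy).differentiableWithinAt) (fun _ => 0)
      (fun y hy j => hzero y hy k i j)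
    exact ⟨a, fun y hy => by simpa using ha y hy⟩
  choose a ha using hconst
  choose q hq using fun k => exists_affine_of_partial_const hUopen hUconn.isPreconnected
    ((hΦ k).differentiableOn (by simp)) (a k) (fun y hy i => ha k i y hy)
  exact ⟨q, a, fun y hy k => hq k y hy⟩
end

section
/- Let R be a ring in which 2x = 0 implies x = 0, and let κ : R → R be an additive map that is anti-multiplicative, i.e. κ(ab) = κ(b)κ(a) for all a,b ∈ R. Let N ≥ 1 and let Q_{ij} ∈ R for 1 ≤ i,j ≤ N satisfy: (i) κ(Q_{ij}) = Q_{ji} for all i,j; (ii) Q_{ij}Q_{kj} = Q_{kj}Q_{ij} for all i,j,k; and (iii) Q_{ik}Q_{jl} + Q_{il}Q_{jk} = Q_{jk}Q_{il} + Q_{jl}Q_{ik} for all i,j,k,l. Then all the elements Q_{ij} pairwise commute: Q_{ik}Q_{jl} = Q_{jl}Q_{ik} for all i,j,k,l. -/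
/-- the antipode/commutation computation forcing the matrix entries
of the quantum group action to commute. -/
theorem stmt_2 {R : Type*} [Ring R] (h2 : ∀ x : R, 2 * x = 0 → x = 0)
    (κ : R → R) (hadd : ∀ a b : R, κ (a + b) = κ a + κ b)
    (hmul : ∀ a b : R, κ (a * b) = κ b * κ a)
    (N : ℕ) (hN : 1 ≤ N) (Q : Fin N → Fin N → R)
    (hκQ : ∀ i j, κ (Q i j) = Q j i)
    (hcol : ∀ i j k, Q i j * Q k j = Q k j * Q i j)
    (hrel : ∀ i j k l,
      Q i k * Q j l + Q i l * Q j k = Q j k * Q i l + Q j l * Q i k) :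
    ∀ i j k l, Q i k * Q j l = Q j l * Q i k := by
  intro i j k l
  have hκrel := congrArg κ (hrel l k j i)
  simp only [hadd, hmul, hκQ] at hκrel
  refine sub_eq_zero.mp (h2 _ ?_)
  calc
    2 * (Q i k * Q j l - Q j l * Q i k)
      = (Q i k * Q j l + Q i l * Q j k - (Q j k * Q i l + Q j l * Q i k)) +
          (Q i k * Q j l + Q j k * Q i l - (Q i l * Q j k + Q j l * Q i k)) := by
        rw [two_mul]
        abel
    _ = 0 := by rw [sub_eq_zero.mpr (hrel i j k l), sub_eq_zero.mpr hκrel, add_zero]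
end

section
/- Let E be a complex Banach space, n ≥ 1, and U ⊆ ℝ^n an open set. Let F : U → E be a continuous map such that for every continuous linear functional ℓ : E → ℂ the function ℓ ∘ F : U → ℂ is infinitely differentiable on U. Then F is infinitely differentiable (C^∞) on U as an E-valued map; in particular all partial derivatives ∂^α F of all orders exist at every point of U. -/
/-- A family of vectors that is dominated by a gauge `c` after composition with every functional
is dominated by `c` in norm. -/
theorem exists_norm_le_of_forall_dual {E ι : Type*} [NormedAddCommGroup E] [NormedSpace ℂ E]
    (u : ι → E) (c : ι → ℝ) (hc : ∀ i, 0 ≤ c i)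
    (h : ∀ ℓ : E →L[ℂ] ℂ, ∃ C, ∀ i, ‖ℓ (u i)‖ ≤ C * c i) :
    ∃ M, 0 ≤ M ∧ ∀ i, ‖u i‖ ≤ M * c i := by
  obtain ⟨M, hM⟩ := banach_steinhaus
    (g := fun i => NormedSpace.inclusionInDoubleDualLi (E := E) ℂ ((c i)⁻¹ • u i)) (by
      intro ℓ
      obtain ⟨C, hC⟩ := h ℓ
      refine ⟨|C|, fun i => ?_⟩
      change ‖ℓ ((c i)⁻¹ • u i)‖ ≤ |C|
      rw [ContinuousLinearMap.map_smul_of_tower, norm_smul, norm_inv, Real.norm_of_nonneg (hc i)]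
      rcases (hc i).eq_or_lt with h0 | h0
      · simp [← h0]
      · rw [inv_mul_le_iff₀ h0, mul_comm]
        exact (hC i).trans (by gcongr; exact le_abs_self C))
  refine ⟨|M|, abs_nonneg M, fun i => ?_⟩
  rcases (hc i).eq_or_lt with h0 | h0
  · have : u i = 0 := SeparatingDual.eq_zero_of_forall_dual_eq_zero (R := ℂ) fun ℓ => by
      obtain ⟨C, hC⟩ := h ℓ
      simpa [← h0] using hC i
    simp [this, ← h0]
  · have := (hM i).trans (le_abs_self M)
    rw [LinearIsometry.norm_map, norm_smul, norm_inv, Real.norm_of_nonneg (hc i),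
      inv_mul_le_iff₀ h0, mul_comm] at this
    exact this

/-- The first-order Taylor remainder of a `C²` function on a compact ball is at most quadratic. -/
theorem ContDiffOn.exists_norm_taylor_remainder_le {V G : Type*} [NormedAddCommGroup V]
    [NormedSpace ℝ V] [ProperSpace V] [NormedAddCommGroup G] [NormedSpace ℝ G] {U : Set V}
    (hU : IsOpen U) {f : V → G} (hf : ContDiffOn ℝ 2 f U) {x : V} {r : ℝ}
    (hr : Metric.closedBall x r ⊆ U) :
    ∃ C, ∀ h : V, ‖h‖ ≤ r → ‖f (x + h) - f x - fderiv ℝ f x h‖ ≤ C * ‖h‖ ^ 2 := by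
  have hf' : ContDiffOn ℝ 1 (fderiv ℝ f) U := hf.fderiv_of_isOpen hU (by norm_num)
  have hf'' : ContinuousOn (fderiv ℝ (fderiv ℝ f)) U :=
    hf'.continuousOn_fderiv_of_isOpen hU (by norm_num)
  obtain ⟨C, hC⟩ := (isCompact_closedBall x r).exists_bound_of_continuousOn
    (f := fderiv ℝ (fderiv ℝ f)) (hf''.mono hr)
  refine ⟨C, fun h hh => ?_⟩
  have hsub : Metric.closedBall x ‖h‖ ⊆ Metric.closedBall x r :=
    Metric.closedBall_subset_closedBall hh
  have hx : x ∈ Metric.closedBall x ‖h‖ := Metric.mem_closedBall_self (norm_nonneg h)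
  have hC0 : 0 ≤ C := (norm_nonneg _).trans (hC x (hsub hx))
  have key : ∀ y ∈ Metric.closedBall x ‖h‖, ‖fderiv ℝ f y - fderiv ℝ f x‖ ≤ C * ‖h‖ := by
    intro y hy
    refine ((convex_closedBall x ‖h‖).norm_image_sub_le_of_norm_fderiv_le (𝕜 := ℝ)
      (fun z hz => (hf'.differentiableOn (by norm_num)).differentiableAt
        (hU.mem_nhds (hr (hsub hz)))) (fun z hz => hC z (hsub hz)) hx hy).trans ?_
    gcongr
    simpa [dist_eq_norm] using hy
  have := (convex_closedBall x ‖h‖).norm_image_sub_le_of_norm_fderiv_le' (𝕜 := ℝ)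
    (fun z hz => (hf.differentiableOn (by norm_num)).differentiableAt
        (hU.mem_nhds (hr (hsub hz)))) key hx (y := x + h) (by simp)
  simpa [pow_two, mul_assoc] using this

/-- A weakly `C²` map into a Banach space is Fréchet differentiable. -/
theorem differentiableAt_of_forall_dual_contDiffOn {V E : Type*} [NormedAddCommGroup V]
    [NormedSpace ℝ V] [FiniteDimensional ℝ V] [NormedAddCommGroup E] [NormedSpace ℂ E]
    [CompleteSpace E] {U : Set V} (hU : IsOpen U) {F : V → E}
    (hF : ∀ ℓ : E →L[ℂ] ℂ, ContDiffOn ℝ 2 (fun x => ℓ (F x)) U) {x : V} (hx : x ∈ U) :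
    DifferentiableAt ℝ F x := by
  have : ProperSpace V := FiniteDimensional.proper ℝ V
  obtain ⟨r, hr0, hr⟩ := Metric.nhds_basis_closedBall.mem_iff.1 (hU.mem_nhds hx)
  have hT := fun ℓ => (hF ℓ).exists_norm_taylor_remainder_le hU hr
  have hsmall : ∀ v : V, ‖v‖ ≤ r →
      ∃ e : E, ∀ ℓ : E →L[ℂ] ℂ, ℓ e = fderiv ℝ (fun x => ℓ (F x)) x v := by
    intro v hv
    set t : ℕ → ℝ := fun k => 1 / ((k : ℝ) + 1) with ht
    have ht0 : ∀ k, 0 < t k := fun k => by positivity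
    have ht1 : ∀ k, t k ≤ 1 := fun k => by
      simp only [ht]; rw [div_le_one (by positivity)]; linarith [(k.cast_nonneg : (0:ℝ) ≤ k)]
    have htend : Filter.Tendsto t Filter.atTop (nhds 0) := tendsto_one_div_add_atTop_nhds_zero_nat
    set u : ℕ → E := fun k => (t k)⁻¹ • (F (x + t k • v) - F x) with hu
    have hlu : ∀ ℓ : E →L[ℂ] ℂ, ∃ C, 0 ≤ C ∧
        ∀ k, ‖ℓ (u k) - fderiv ℝ (fun x => ℓ (F x)) x v‖ ≤ C * t k := by
      intro ℓ
      obtain ⟨C, hC⟩ := hT ℓ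
      refine ⟨|C| * ‖v‖ ^ 2, by positivity, fun k => ?_⟩
      have h1 := hC (t k • v) (by
        rw [norm_smul, Real.norm_of_nonneg (ht0 k).le]
        exact (mul_le_of_le_one_left (norm_nonneg v) (ht1 k)).trans hv)
      have h2 : ℓ (u k) - fderiv ℝ (fun x => ℓ (F x)) x v = (t k)⁻¹ • (ℓ (F (x + t k • v)) - ℓ (F x)
          - fderiv ℝ (fun x => ℓ (F x)) x (t k • v)) := by
        rw [hu, ContinuousLinearMap.map_smul_of_tower, map_sub, map_smul, smul_sub _ _ (_ • _),
          inv_smul_smul₀ (ht0 k).ne']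
      rw [h2, norm_smul, norm_inv, Real.norm_of_nonneg (ht0 k).le, inv_mul_le_iff₀ (ht0 k)]
      refine h1.trans ?_
      rw [norm_smul, Real.norm_of_nonneg (ht0 k).le]
      calc C * (t k * ‖v‖) ^ 2 ≤ |C| * (t k * ‖v‖) ^ 2 := by gcongr; exact le_abs_self C
        _ = _ := by ring
    obtain ⟨M, hM0, hM⟩ := exists_norm_le_of_forall_dual
      (fun p : ℕ × ℕ => u p.1 - u p.2) (fun p => t p.1 + t p.2)
      (fun p => (add_pos (ht0 _) (ht0 _)).le) (by
        intro ℓ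
        obtain ⟨C, hC0, hC⟩ := hlu ℓ
        refine ⟨C, fun p => ?_⟩
        rw [map_sub, mul_add]
        refine (norm_sub_le_norm_sub_add_norm_sub _ (fderiv ℝ (fun x => ℓ (F x)) x v) _).trans ?_
        rw [norm_sub_rev (fderiv ℝ (fun x => ℓ (F x)) x v)]
        exact add_le_add (hC _) (hC _))
    have hcau : CauchySeq u := by
      refine cauchySeq_of_le_tendsto_0 (fun N => M * (t N + t N)) (fun k m N hk hm => ?_)
        (by simpa using (htend.add htend).const_mul M)
      rw [dist_eq_norm]
      have hmono : ∀ {k}, N ≤ k → t k ≤ t N := fun h => one_div_le_one_div_of_le (by positivity)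
        (by gcongr)
      exact (hM (k, m)).trans (mul_le_mul_of_nonneg_left (add_le_add (hmono hk) (hmono hm)) hM0)
    obtain ⟨e, he⟩ := cauchySeq_tendsto_of_complete hcau
    refine ⟨e, fun ℓ => tendsto_nhds_unique ((ℓ.continuous.tendsto e).comp he) ?_⟩
    obtain ⟨C, -, hC⟩ := hlu ℓ
    rw [tendsto_iff_norm_sub_tendsto_zero]
    exact squeeze_zero (fun _ => norm_nonneg _) hC (by simpa using htend.const_mul C)
  have hall : ∀ v : V, ∃ e : E, ∀ ℓ : E →L[ℂ] ℂ, ℓ e = fderiv ℝ (fun x => ℓ (F x)) x v := by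
    intro v
    have hd : 0 < r / (‖v‖ + 1) := by positivity
    obtain ⟨e, he⟩ := hsmall ((r / (‖v‖ + 1)) • v) (by
      rw [norm_smul, Real.norm_of_nonneg hd.le, div_mul_eq_mul_div, div_le_iff₀ (by positivity)]
      gcongr
      linarith)
    refine ⟨(r / (‖v‖ + 1))⁻¹ • e, fun ℓ => ?_⟩
    rw [ContinuousLinearMap.map_smul_of_tower, he, map_smul, inv_smul_smul₀ hd.ne']
  choose A hA using hall
  let L : V →ₗ[ℝ] E :=
    { toFun := A
      map_add' := fun v w => (SeparatingDual.eq_iff_forall_dual_eq (R := ℂ)).2 fun ℓ => by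
        simp [hA]
      map_smul' := fun c v => (SeparatingDual.eq_iff_forall_dual_eq (R := ℂ)).2 fun ℓ => by
        simp only [RingHom.id_apply]
        rw [ContinuousLinearMap.map_smul_of_tower, hA, hA, map_smul] }
  obtain ⟨M, -, hM⟩ := exists_norm_le_of_forall_dual
    (fun h : Metric.closedBall (0 : V) r => F (x + h) - F x - A h) (fun h => ‖(h : V)‖ ^ 2)
    (fun h => by positivity) (by
      intro ℓ
      obtain ⟨C, hC⟩ := hT ℓ
      refine ⟨C, fun h => ?_⟩
      simpa [hA] using hC h (mem_closedBall_zero_iff.1 h.2))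
  refine HasFDerivAt.differentiableAt (f' := LinearMap.toContinuousLinearMap L) ?_
  rw [hasFDerivAt_iff_isLittleO_nhds_zero]
  refine Asymptotics.IsBigO.trans_isLittleO (g := fun h : V => ‖h‖ ^ 2) ?_ ?_
  · refine Asymptotics.IsBigO.of_bound M ?_
    filter_upwards [Metric.closedBall_mem_nhds (0 : V) hr0] with h hh
    simpa [L] using hM ⟨h, hh⟩
  · exact Asymptotics.isLittleO_norm_pow_id one_lt_two

/-- A weakly smooth map from an open subset of a finite-dimensional space into a Banach space is
smooth. -/
theorem contDiffOn_of_forall_dual_contDiffOn {V E : Type*} [NormedAddCommGroup V]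
    [NormedSpace ℝ V] [FiniteDimensional ℝ V] [NormedAddCommGroup E] [NormedSpace ℂ E]
    [CompleteSpace E] {U : Set V} (hU : IsOpen U) {F : V → E}
    (hF : ∀ ℓ : E →L[ℂ] ℂ, ContDiffOn ℝ (⊤ : ℕ∞) (fun x => ℓ (F x)) U) :
    ContDiffOn ℝ (⊤ : ℕ∞) F U := by
  refine contDiffOn_infty.2 fun m => ?_
  induction m generalizing F with
  | zero =>
    exact contDiffOn_zero.2 fun x hx => (differentiableAt_of_forall_dual_contDiffOn hU
      (fun ℓ => contDiffOn_infty.1 (hF ℓ) 2) hx).continuousAt.continuousWithinAt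
  | succ m ih =>
    have hd : ∀ x ∈ U, DifferentiableAt ℝ F x := fun x hx =>
      differentiableAt_of_forall_dual_contDiffOn hU
        (fun ℓ => contDiffOn_infty.1 (hF ℓ) 2) hx
    push_cast
    rw [contDiffOn_succ_iff_fderiv_of_isOpen hU]
    refine ⟨fun x hx => (hd x hx).differentiableWithinAt, by simp, ?_⟩
    rw [contDiffOn_clm_apply]
    refine fun v => ih fun ℓ => ?_
    have h1 : ContDiffOn ℝ (⊤ : ℕ∞) (fderiv ℝ fun x => ℓ (F x)) U :=
      (hF ℓ).fderiv_of_isOpen hU (by simp)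
    refine (h1.clm_apply contDiffOn_const (g := fun _ => v)).congr fun x hx => ?_
    have h2 : HasFDerivAt (fun x => ℓ (F x)) ((ℓ.restrictScalars ℝ).comp (fderiv ℝ F x)) x :=
      (ℓ.restrictScalars ℝ).hasFDerivAt.comp x (hd x hx).hasFDerivAt
    rw [h2.fderiv]
    rfl

/-- a continuous map from an open subset of ℝ^n into a complex Banach
space which is weakly C^∞ (after composing with every continuous linear functional)
is C^∞. -/
theorem stmt_4 {E : Type*} [NormedAddCommGroup E] [NormedSpace ℂ E] [CompleteSpace E]
    (n : ℕ) (hn : 1 ≤ n) (U : Set (Fin n → ℝ)) (hU : IsOpen U)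
    (F : (Fin n → ℝ) → E) (hF : ContinuousOn F U)
    (hweak : ∀ ℓ : E →L[ℂ] ℂ, ContDiffOn ℝ (⊤ : ℕ∞) (fun x => ℓ (F x)) U) :
    ContDiffOn ℝ (⊤ : ℕ∞) F U := by
  exact contDiffOn_of_forall_dual_contDiffOn hU hweak
end
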